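/- Fix an integer n ≥ 1. The expected number of flips used by optimal_uniform(n) satisfies E[T] ≤ ⌈log₂ n⌉ + 1, i.e., ∫ T dμ ≤ ⌈log₂ n⌉ + 1. -/

import Mathlib

open MeasureTheory
open scoped ENNReal NNReal

/-- One step of the `optimal_uniform n` algorithm: from state `(X, m)`, driven by a
fair coin flip `B`.  The state with `m = n` is absorbing. -/
def kyStep (n : ℕ) (s : ℕ × ℕ) (B : Bool) : ℕ × ℕ :=
  if s.2 = n then s
  else
    let X' := s.1 + (if B then s.2 else 0)
    let m' := 2 * s.2
    if n ≤ m' then (if X' ≤ n then (X', n) else (X' - n, m' - n)) else (X', m')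

/-- The state `(X_k b, m_k b)` after `k` coin flips, starting from `(1, 1)`. -/
def kyState (n : ℕ) (b : ℕ → Bool) : ℕ → ℕ × ℕ
  | 0 => (1, 1)
  | k + 1 => kyStep n (kyState n b k) (b k)

/-- The number of flips used by `optimal_uniform n`: the first time `m_k = n`
(`⊤` if the algorithm never terminates). -/
noncomputable def kyT (n : ℕ) (b : ℕ → Bool) : ℕ∞ :=
  ⨅ (k : ℕ) (_ : (kyState n b k).2 = n), (k : ℕ∞)

theorem measurable_kyState (n k : ℕ) : Measurable fun b : ℕ → Bool => kyState n b k := by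
  induction k with
  | zero => exact measurable_const
  | succ k ih =>
    exact (Measurable.of_discrete (f := fun p : (ℕ × ℕ) × Bool => kyStep n p.1 p.2)).comp
      (ih.prodMk (measurable_pi_apply k))

theorem kyState_succ_ne {n k : ℕ} {b : ℕ → Bool} (h : (kyState n b (k + 1)).2 ≠ n) :
    (kyState n b k).2 ≠ n := by
  intro hk
  apply h
  simp [kyState, kyStep, hk]

/-- A running state `(X, m)` after `k` flips has `m = 2 ^ k % n` and `1 ≤ X ≤ m`. -/
theorem kyState_mem_of_ne {n k : ℕ} (hn : 1 ≤ n) {b : ℕ → Bool} (h : (kyState n b k).2 ≠ n) :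
    (kyState n b k).2 = 2 ^ k % n ∧ 1 ≤ (kyState n b k).1 ∧
      (kyState n b k).1 ≤ (kyState n b k).2 := by
  induction k with
  | zero =>
    have h1 : 1 ≠ n := h
    simp [kyState, Nat.mod_eq_of_lt (show 1 < n by omega)]
  | succ k ih =>
    have hk := kyState_succ_ne h
    obtain ⟨h1, h2, h3⟩ := ih hk
    have hlt : (kyState n b k).2 < n := h1 ▸ Nat.mod_lt _ hn
    have hpow : 2 ^ (k + 1) % n = 2 * (kyState n b k).2 % n := by
      rw [h1, Nat.mul_mod_mod, pow_succ']
    rw [hpow]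
    simp only [kyState, kyStep, if_neg hk] at h ⊢
    generalize kyState n b k = s at *
    obtain ⟨X, m⟩ := s
    simp only at *
    by_cases hm : n ≤ 2 * m
    · have hmod : 2 * m % n = 2 * m - n := by
        rw [Nat.mod_eq_sub_mod hm, Nat.mod_eq_of_lt (by omega)]
      rw [if_pos hm] at h ⊢
      split_ifs at h ⊢ <;> simp only [hmod, ne_eq, not_true_eq_false, true_and] at * <;> omega
    · rw [if_neg hm, Nat.mod_eq_of_lt (by omega)]
      refine ⟨rfl, ?_, ?_⟩ <;> dsimp only <;> split_ifs <;> omega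

/-- A running state determines the flips that led to it. -/
theorem eq_of_kyState_eq {n k : ℕ} (hn : 1 ≤ n) {b c : ℕ → Bool} (h : (kyState n b k).2 ≠ n)
    (hbc : kyState n b k = kyState n c k) : ∀ i < k, b i = c i := by
  induction k with
  | zero => simp
  | succ k ih =>
    have hb := kyState_succ_ne h
    have hc := kyState_succ_ne (hbc ▸ h)
    obtain ⟨b1, b2, b3⟩ := kyState_mem_of_ne hn hb
    obtain ⟨c1, c2, c3⟩ := kyState_mem_of_ne hn hc
    have hlt : (kyState n b k).2 < n := b1 ▸ Nat.mod_lt _ hn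
    have hm : (kyState n b k).2 = (kyState n c k).2 := b1.trans c1.symm
    have key : kyState n b k = kyState n c k ∧ b k = c k := by
      clear ih b1 c1
      simp only [kyState, kyStep, if_neg hb, if_neg hc] at h hbc
      generalize kyState n b k = s at *
      generalize kyState n c k = t at *
      obtain ⟨X, m⟩ := s
      obtain ⟨Y, m'⟩ := t
      simp only at *
      subst hm
      generalize b k = B at *
      generalize c k = C at *
      cases B <;> cases C <;> simp only [if_true, if_false, Bool.false_eq_true] at * <;>
        split_ifs at * <;> simp only [Prod.mk.injEq] at * <;> simp <;> omega
    intro i hi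
    rcases Nat.lt_succ_iff_lt_or_eq.mp hi with hi | rfl
    · exact ih hb key.1 i hi
    · exact key.2

theorem measure_kyState_ne_le {n : ℕ} (hn : 1 ≤ n) (μ : Measure (ℕ → Bool))
    (hμ : ∀ (k : ℕ) (f : ℕ → Bool), μ {b | ∀ i < k, b i = f i} = (2 : ℝ≥0∞)⁻¹ ^ k) (k : ℕ) :
    μ {b | (kyState n b k).2 ≠ n} ≤ ((2 ^ k % n : ℕ) : ℝ≥0∞) * (2 : ℝ≥0∞)⁻¹ ^ k := by
  have hsub : {b | (kyState n b k).2 ≠ n} ⊆ ⋃ x ∈ Finset.Icc 1 (2 ^ k % n),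
      {b | (kyState n b k).2 ≠ n ∧ (kyState n b k).1 = x} := by
    intro b hb
    obtain ⟨h1, h2, h3⟩ := kyState_mem_of_ne hn hb
    simp only [Set.mem_iUnion, Finset.mem_Icc]
    exact ⟨_, ⟨h2, h1 ▸ h3⟩, hb, rfl⟩
  have hfiber (x : ℕ) :
      μ {b | (kyState n b k).2 ≠ n ∧ (kyState n b k).1 = x} ≤ (2 : ℝ≥0∞)⁻¹ ^ k := by
    rcases Set.eq_empty_or_nonempty {b | (kyState n b k).2 ≠ n ∧ (kyState n b k).1 = x}
      with h | ⟨c, hc, hcx⟩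
    · simp [h]
    · rw [← hμ k c]
      refine measure_mono fun b hb => eq_of_kyState_eq hn hb.1 (Prod.ext (hb.2.trans hcx.symm) ?_)
      exact (kyState_mem_of_ne hn hb.1).1.trans (kyState_mem_of_ne hn hc).1.symm
  calc μ {b | (kyState n b k).2 ≠ n}
      ≤ ∑ x ∈ Finset.Icc 1 (2 ^ k % n),
          μ {b | (kyState n b k).2 ≠ n ∧ (kyState n b k).1 = x} :=
        (measure_mono hsub).trans (measure_biUnion_finset_le _ _)
    _ ≤ ∑ _x ∈ Finset.Icc 1 (2 ^ k % n), (2 : ℝ≥0∞)⁻¹ ^ k := Finset.sum_le_sum fun x _ => hfiber x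
    _ = _ := by simp

theorem kyT_le_tsum (n : ℕ) (b : ℕ → Bool) :
    (kyT n b : ℝ≥0∞) ≤ ∑' k, {b | (kyState n b k).2 ≠ n}.indicator 1 b := by
  by_cases h : ∃ k, (kyState n b k).2 = n
  · have hT : kyT n b ≤ (Nat.find h : ℕ∞) := iInf₂_le (Nat.find h) (Nat.find_spec h)
    calc (kyT n b : ℝ≥0∞) ≤ ((Nat.find h : ℕ∞) : ℝ≥0∞) := ENat.toENNReal_le.mpr hT
      _ = ∑ k ∈ Finset.range (Nat.find h), {b | (kyState n b k).2 ≠ n}.indicator 1 b := by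
        rw [Finset.sum_congr rfl fun k hk => Set.indicator_of_mem
          (s := {b | (kyState n b k).2 ≠ n}) (Nat.find_min h (Finset.mem_range.mp hk)) 1]
        simp
      _ ≤ _ := ENNReal.sum_le_tsum _
  · push Not at h
    have : ∀ k, {b | (kyState n b k).2 ≠ n}.indicator (1 : (ℕ → Bool) → ℝ≥0∞) b = 1 :=
      fun k => Set.indicator_of_mem (s := {b | (kyState n b k).2 ≠ n}) (h k) 1
    simp [this]

theorem two_pow_mod_mul_inv_two_pow_le_one (n k : ℕ) :
    ((2 ^ k % n : ℕ) : ℝ≥0∞) * (2 : ℝ≥0∞)⁻¹ ^ k ≤ 1 := by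
  calc ((2 ^ k % n : ℕ) : ℝ≥0∞) * (2 : ℝ≥0∞)⁻¹ ^ k
      ≤ ((2 ^ k : ℕ) : ℝ≥0∞) * (2 : ℝ≥0∞)⁻¹ ^ k := by gcongr; exact Nat.mod_le _ _
    _ = 1 := by
      rw [Nat.cast_pow, Nat.cast_ofNat, ← mul_pow, ENNReal.mul_inv_cancel (by simp) (by simp),
        one_pow]

theorem two_pow_clog_mod_add {n : ℕ} (hn : 1 ≤ n) :
    2 ^ Nat.clog 2 n % n + n = 2 ^ Nat.clog 2 n := by
  have hle : n ≤ 2 ^ Nat.clog 2 n := Nat.le_pow_clog (by norm_num) n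
  have hlt : 2 ^ Nat.clog 2 n < 2 * n := by
    rcases hn.eq_or_lt with rfl | hn
    · simp
    · have h := Nat.pow_pred_clog_lt_self (b := 2) (by norm_num) hn
      have hpos : 0 < Nat.clog 2 n := Nat.clog_pos (by norm_num) hn
      have : 2 ^ Nat.clog 2 n = 2 * 2 ^ (Nat.clog 2 n).pred := by
        rw [← pow_succ', ← Nat.succ_eq_add_one, Nat.succ_pred_eq_of_pos hpos]
      omega
  rw [Nat.mod_eq_sub_mod hle, Nat.mod_eq_of_lt (by omega)]
  omega

theorem sum_two_pow_mod_add_le {n : ℕ} (hn : 1 ≤ n) (j : ℕ) :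
    ∑ k ∈ Finset.range (Nat.clog 2 n + j), ((2 ^ k % n : ℕ) : ℝ≥0∞) * (2 : ℝ≥0∞)⁻¹ ^ k +
      ((2 ^ (Nat.clog 2 n + j) % n + n : ℕ) : ℝ≥0∞) * (2 : ℝ≥0∞)⁻¹ ^ (Nat.clog 2 n + j) ≤
      (Nat.clog 2 n : ℝ≥0∞) + 1 := by
  induction j with
  | zero =>
    rw [add_zero, two_pow_clog_mod_add hn]
    gcongr
    · refine (Finset.sum_le_sum fun k _ => two_pow_mod_mul_inv_two_pow_le_one n k).trans ?_
      simp
    · rw [Nat.cast_pow, Nat.cast_ofNat, ← mul_pow, ENNReal.mul_inv_cancel (by simp) (by simp),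
        one_pow]
  | succ j ih =>
    refine le_trans ?_ ih
    rw [← add_assoc, Finset.sum_range_succ, add_assoc]
    gcongr
    generalize Nat.clog 2 n + j = k
    have hq : (2 : ℝ≥0∞)⁻¹ ^ k = 2 * (2 : ℝ≥0∞)⁻¹ ^ (k + 1) := by
      rw [pow_succ', ← mul_assoc, ENNReal.mul_inv_cancel (by simp) (by simp), one_mul]
    have hmod : 2 ^ (k + 1) % n < n := Nat.mod_lt _ hn
    rw [hq, ← mul_assoc, ← mul_assoc, ← add_mul]
    gcongr
    norm_cast
    omega

theorem tsum_two_pow_mod_le {n : ℕ} (hn : 1 ≤ n) :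
    ∑' k, ((2 ^ k % n : ℕ) : ℝ≥0∞) * (2 : ℝ≥0∞)⁻¹ ^ k ≤ (Nat.clog 2 n : ℝ≥0∞) + 1 := by
  refine ENNReal.tsum_le_of_sum_range_le fun j => ?_
  refine (Finset.sum_le_sum_of_subset ?_).trans
    (le_self_add.trans (sum_two_pow_mod_add_le hn j))
  exact Finset.range_mono (Nat.le_add_left _ _)

/-- The expected number of flips used by `optimal_uniform n` is at
most `⌈log₂ n⌉ + 1`. -/
theorem optimal_uniform_expected_flips (n : ℕ) (hn : 1 ≤ n)
    (μ : Measure (ℕ → Bool)) [IsProbabilityMeasure μ]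
    (hμ : ∀ (k : ℕ) (f : ℕ → Bool), μ {b | ∀ i < k, b i = f i} = (2 : ℝ≥0∞)⁻¹ ^ k) :
    ∫⁻ b, (kyT n b : ℝ≥0∞) ∂μ ≤ (Nat.clog 2 n : ℝ≥0∞) + 1 := by
  have hmeas (k : ℕ) : MeasurableSet {b | (kyState n b k).2 ≠ n} :=
    (measurable_kyState n k).snd (MeasurableSet.of_discrete (s := {m | m ≠ n}))
  calc ∫⁻ b, (kyT n b : ℝ≥0∞) ∂μ
      ≤ ∫⁻ b, ∑' k, {b | (kyState n b k).2 ≠ n}.indicator 1 b ∂μ :=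
        lintegral_mono fun b => kyT_le_tsum n b
    _ = ∑' k, μ {b | (kyState n b k).2 ≠ n} := by
        rw [lintegral_tsum fun k => (measurable_one.indicator (hmeas k)).aemeasurable]
        exact tsum_congr fun k => lintegral_indicator_one (hmeas k)
    _ ≤ ∑' k, ((2 ^ k % n : ℕ) : ℝ≥0∞) * (2 : ℝ≥0∞)⁻¹ ^ k :=
        ENNReal.tsum_le_tsum fun k => measure_kyState_ne_le hn μ hμ k
    _ ≤ _ := tsum_two_pow_mod_le hn
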